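/- Let (C^{p,q})_{p,q ≥ 0} be a double complex of abelian groups with differentials d : C^{p,q} → C^{p,q+1} and δ : C^{p,q} → C^{p+1,q} satisfying d∘d = 0, δ∘δ = 0, d∘δ = δ∘d, and suppose δ is exact: for all p ≥ 1 and all q, ker(δ : C^{p,q} → C^{p+1,q}) = im(δ : C^{p−1,q} → C^{p,q}). Set C^{−1,q} := ker(δ : C^{0,q} → C^{1,q}); then d restricts to a differential on the complex (C^{−1,q})_q. The inclusion of C^{−1,r} into the total complex C^r = ⊕_{p+q=r} C^{p,q} (with total differential D = (−1)^q δ + d on C^{p,q}) induces an isomorphism from the r-th cohomology of the complex (C^{−1,•}, d) to the r-th cohomology of the total complex (C^•, D), for every r. -/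

import Mathlib

/-- Transport an element of a doubly-indexed family along equalities of the indices. -/
def castC (C : ℕ → ℕ → Type*) {p q p' q' : ℕ} (hp : p = p') (hq : q = q')
    (x : C p q) : C p' q' :=
  cast (by rw [hp, hq]) x

/-- The total differential of a double complex, acting on families `α : ∀ p q, C p q`:
`(D α) (p,q) = d (α (p, q-1)) + (-1)^q δ (α (p-1, q))`, i.e. `D` restricts to
`(-1)^q δ + d` on the summand `C^{p,q}`. -/
def Dfun (C : ℕ → ℕ → Type*) [∀ p q, AddCommGroup (C p q)]
    (d : ∀ p q, C p q →+ C p (q + 1)) (δ : ∀ p q, C p q →+ C (p + 1) q)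
    (α : ∀ p q, C p q) : ∀ p q, C p q :=
  fun p q =>
    (if h : 1 ≤ q then castC C rfl (by omega) (d p (q - 1) (α p (q - 1))) else 0) +
    (if h : 1 ≤ p then
      ((-1 : ℤ) ^ q) • castC C (by omega) rfl (δ (p - 1) q (α (p - 1) q)) else 0)

/-- The inclusion of the summand `C^{p,q}` into the total group `∀ p q, C p q`. -/
def ιfun (C : ℕ → ℕ → Type*) [∀ p q, AddCommGroup (C p q)] (p q : ℕ) (x : C p q) :
    ∀ p' q', C p' q' :=
  fun p' q' => if h : p = p' ∧ q = q' then castC C h.1 h.2 x else 0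

section DoubleComplex

variable {C : ℕ → ℕ → Type*} [∀ p q, AddCommGroup (C p q)]
  {d : ∀ p q, C p q →+ C p (q + 1)} {δ : ∀ p q, C p q →+ C (p + 1) q}

theorem Dfun_zero_zero (α : ∀ p q, C p q) : Dfun C d δ α 0 0 = 0 := by
  simp [Dfun]

theorem Dfun_zero_succ (α : ∀ p q, C p q) (q : ℕ) :
    Dfun C d δ α 0 (q + 1) = d 0 q (α 0 q) := by
  simp [Dfun, castC]

theorem Dfun_succ_zero (α : ∀ p q, C p q) (p : ℕ) :
    Dfun C d δ α (p + 1) 0 = δ p 0 (α p 0) := by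
  simp [Dfun, castC]

theorem Dfun_succ_succ (α : ∀ p q, C p q) (p q : ℕ) :
    Dfun C d δ α (p + 1) (q + 1) =
      d (p + 1) q (α (p + 1) q) + (-1 : ℤ) ^ (q + 1) • δ p (q + 1) (α p (q + 1)) := by
  simp [Dfun, castC]

theorem Dfun_sub (α β : ∀ p q, C p q) :
    Dfun C d δ (α - β) = Dfun C d δ α - Dfun C d δ β := by
  funext p q
  rcases p with _ | p <;> rcases q with _ | q <;>
    simp only [Pi.sub_apply, Dfun_zero_zero, Dfun_zero_succ, Dfun_succ_zero, Dfun_succ_succ,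
      map_sub, smul_sub] <;> abel

theorem Dfun_zero : Dfun C d δ 0 = 0 := by
  simpa using Dfun_sub (d := d) (δ := δ) (0 : ∀ p q, C p q) 0

theorem Dfun_Dfun (hdd : ∀ p q (x : C p q), d p (q + 1) (d p q x) = 0)
    (hδδ : ∀ p q (x : C p q), δ (p + 1) q (δ p q x) = 0)
    (hcomm : ∀ p q (x : C p q), d (p + 1) q (δ p q x) = δ p (q + 1) (d p q x))
    (α : ∀ p q, C p q) : Dfun C d δ (Dfun C d δ α) = 0 := by
  funext p q
  rcases p with _ | _ | p <;> rcases q with _ | _ | q <;>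
    simp [Dfun_zero_zero, Dfun_zero_succ, Dfun_succ_zero, Dfun_succ_succ, hdd, hδδ, hcomm,
      pow_succ]

/-- The total differential raises the total degree by one. -/
theorem Dfun_eq_zero_of_degree {r : ℕ} {β : ∀ p q, C p q}
    (hβ : ∀ p q, p + q + 1 ≠ r → β p q = 0) {p q : ℕ} (h : p + q ≠ r) :
    Dfun C d δ β p q = 0 := by
  rcases p with _ | p <;> rcases q with _ | q
  · exact Dfun_zero_zero β
  · rw [Dfun_zero_succ, hβ 0 q (by omega), map_zero]
  · rw [Dfun_succ_zero, hβ p 0 (by omega), map_zero]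
  · rw [Dfun_succ_succ, hβ (p + 1) q (by omega), hβ p (q + 1) (by omega)]
    simp

theorem Dfun_succ_of_eq_zero {α : ∀ p q, C p q} {p : ℕ} (h : ∀ q, α (p + 1) q = 0) (q : ℕ) :
    Dfun C d δ α (p + 1) q = (-1 : ℤ) ^ q • δ p q (α p q) := by
  rcases q with _ | q
  · simp [Dfun_succ_zero]
  · simp [Dfun_succ_succ, h]

theorem neg_one_pow_smul_smul {A : Type*} [AddCommGroup A] (q : ℕ) (x : A) :
    (-1 : ℤ) ^ q • (-1 : ℤ) ^ q • x = x := by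
  rw [smul_smul, ← mul_pow]
  simp

theorem ιfun_self (p q : ℕ) (x : C p q) : ιfun C p q x p q = x := by
  simp [ιfun, castC]

theorem ιfun_of_ne {p q p' q' : ℕ} (x : C p q) (h : ¬(p = p' ∧ q = q')) :
    ιfun C p q x p' q' = 0 := by
  simp [ιfun, h]

/-- An element of the kernel column is mapped by the total differential as by `d`. -/
theorem Dfun_ιfun {r : ℕ} {γ : C 0 r} (hγ : δ 0 r γ = 0) :
    Dfun C d δ (ιfun C 0 r γ) = ιfun C 0 (r + 1) (d 0 r γ) := by
  have hrow : ∀ p q, ιfun C 0 r γ (p + 1) q = 0 := fun p q => ιfun_of_ne _ (by omega)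
  funext p q
  rcases p with _ | p
  · rcases q with _ | q
    · rw [Dfun_zero_zero, ιfun_of_ne _ (by omega)]
    · rw [Dfun_zero_succ]
      by_cases h : r = q
      · subst h
        rw [ιfun_self, ιfun_self]
      · rw [ιfun_of_ne _ (by omega), ιfun_of_ne _ (by omega), map_zero]
  · rw [Dfun_succ_of_eq_zero (hrow p), ιfun_of_ne (d 0 r γ) (by omega)]
    rcases p with _ | p
    · by_cases h : r = q
      · subst h
        rw [ιfun_self, hγ, smul_zero]
      · rw [ιfun_of_ne _ (by omega), map_zero, smul_zero]
    · rw [hrow, map_zero, smul_zero]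

/-- If `δ` is exact, a homogeneous element whose total differential is concentrated in the
column `p = 0` differs by a total coboundary from an element of the kernel column. -/
theorem exists_sub_Dfun_eq_ιfun (hdd : ∀ p q (x : C p q), d p (q + 1) (d p q x) = 0)
    (hδδ : ∀ p q (x : C p q), δ (p + 1) q (δ p q x) = 0)
    (hcomm : ∀ p q (x : C p q), d (p + 1) q (δ p q x) = δ p (q + 1) (d p q x))
    (hexact : ∀ p q (x : C (p + 1) q), δ (p + 1) q x = 0 → ∃ y, δ p q y = x)
    {r : ℕ} (n : ℕ) (α : ∀ p q, C p q) (hα : ∀ p q, p + q ≠ r → α p q = 0)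
    (hn : ∀ p q, n < p → α p q = 0) (hD : ∀ p q, Dfun C d δ α (p + 1) q = 0) :
    ∃ γ : C 0 r, δ 0 r γ = 0 ∧ ∃ β : ∀ p q, C p q,
      (∀ p q, p + q + 1 ≠ r → β p q = 0) ∧ α - Dfun C d δ β = ιfun C 0 r γ := by
  induction n generalizing α with
  | zero =>
    refine ⟨α 0 r, ?_, 0, fun _ _ _ => rfl, ?_⟩
    · have h := hD 0 r
      rw [Dfun_succ_of_eq_zero fun q => hn _ _ (by omega)] at h
      rw [← neg_one_pow_smul_smul r (δ 0 r (α 0 r)), h, smul_zero]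
    · rw [Dfun_zero, sub_zero]
      funext p q
      by_cases h : 0 = p ∧ r = q
      · obtain ⟨rfl, rfl⟩ := h
        rw [ιfun_self]
      · rw [ιfun_of_ne _ h]
        by_cases hp : 0 < p
        · exact hn p q hp
        · exact hα p q (by omega)
  | succ n ih =>
    have hδ : ∀ q, δ (n + 1) q (α (n + 1) q) = 0 := fun q => by
      have h := hD (n + 1) q
      rw [Dfun_succ_of_eq_zero fun q => hn _ _ (by omega)] at h
      rw [← neg_one_pow_smul_smul q (δ (n + 1) q (α (n + 1) q)), h, smul_zero]
    have hex : ∀ p q, ∃ y : C p q, (p ≠ n → y = 0) ∧ (p + q + 1 ≠ r → y = 0) ∧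
        (p = n → δ p q y = (-1 : ℤ) ^ q • α (p + 1) q) := fun p q => by
      by_cases hp : p = n
      · subst hp
        by_cases hr : p + q + 1 = r
        · obtain ⟨y, hy⟩ := hexact p q ((-1 : ℤ) ^ q • α (p + 1) q) (by
            rw [map_zsmul, hδ, smul_zero])
          exact ⟨y, fun h => absurd rfl h, fun h => absurd hr h, fun _ => hy⟩
        · refine ⟨0, fun _ => rfl, fun _ => rfl, fun _ => ?_⟩
          rw [hα (p + 1) q (by omega), map_zero, smul_zero]
      · exact ⟨0, fun _ => rfl, fun _ => rfl, fun h => absurd h hp⟩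
    choose β hβn hβr hβ using hex
    obtain ⟨γ, hγ, β', hβ', h⟩ := ih (α - Dfun C d δ β)
      (fun p q h => by
        rw [Pi.sub_apply, Pi.sub_apply, hα p q h, Dfun_eq_zero_of_degree hβr h, sub_zero])
      (fun p q h => by
        obtain ⟨p, rfl⟩ : ∃ k, p = k + 1 := ⟨p - 1, by omega⟩
        rw [Pi.sub_apply, Pi.sub_apply, Dfun_succ_of_eq_zero fun q => hβn _ _ (by omega)]
        by_cases hp : p = n
        · rw [hβ p q hp, neg_one_pow_smul_smul, sub_self]
        · rw [hβn p q hp, hn _ _ (by omega), map_zero, smul_zero, sub_zero])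
      (fun p q => by
        rw [Dfun_sub, Dfun_Dfun hdd hδδ hcomm, sub_zero, hD])
    refine ⟨γ, hγ, β + β', fun p q hpq => ?_, ?_⟩
    · rw [Pi.add_apply, Pi.add_apply, hβr p q hpq, hβ' p q hpq, add_zero]
    · rw [← h, sub_sub, sub_right_inj, ← sub_eq_iff_eq_add', ← Dfun_sub, add_sub_cancel_left]

end DoubleComplex

/-- in a double complex with exact column differential `δ`, the inclusion of
the complex `C^{-1,•} = ker (δ : C^{0,•} → C^{1,•})` (with differential `d`) into the
total complex induces an isomorphism on cohomology in every degree `r`.  This is stated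
elementwise: (surjectivity) every degree-`r` total cocycle differs by a total coboundary
from the inclusion of a `d`-cocycle `γ ∈ C^{-1,r}`; (injectivity) every `d`-cocycle
`γ ∈ C^{-1,r}` whose inclusion is a total coboundary is a `d`-coboundary of some element
of `C^{-1,r-1}` (for `r = 0` this forces `γ = 0`). -/
theorem stmt12 (C : ℕ → ℕ → Type*) [∀ p q, AddCommGroup (C p q)]
    (d : ∀ p q, C p q →+ C p (q + 1)) (δ : ∀ p q, C p q →+ C (p + 1) q)
    (hdd : ∀ p q (x : C p q), d p (q + 1) (d p q x) = 0)
    (hδδ : ∀ p q (x : C p q), δ (p + 1) q (δ p q x) = 0)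
    (hcomm : ∀ p q (x : C p q), d (p + 1) q (δ p q x) = δ p (q + 1) (d p q x))
    (hexact : ∀ p q, ∀ hp : 1 ≤ p, ∀ x : C p q, δ p q x = 0 →
      ∃ y : C (p - 1) q, castC C (by omega) rfl (δ (p - 1) q y) = x)
    (r : ℕ) :
    (∀ α : ∀ p q, C p q, (∀ p q, p + q ≠ r → α p q = 0) → Dfun C d δ α = 0 →
      ∃ γ : C 0 r, δ 0 r γ = 0 ∧ d 0 r γ = 0 ∧
        ∃ β : ∀ p q, C p q, (∀ p q, p + q + 1 ≠ r → β p q = 0) ∧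
          ∀ p q, α p q = ιfun C 0 r γ p q + Dfun C d δ β p q) ∧
    (∀ γ : C 0 r, δ 0 r γ = 0 → d 0 r γ = 0 →
      (∃ β : ∀ p q, C p q, (∀ p q, p + q + 1 ≠ r → β p q = 0) ∧
        ιfun C 0 r γ = Dfun C d δ β) →
      ∃ γ' : C 0 (r - 1), δ 0 (r - 1) γ' = 0 ∧
        ιfun C 0 (r - 1 + 1) (d 0 (r - 1) γ') = ιfun C 0 r γ) := by
  have hexact' : ∀ p q (x : C (p + 1) q), δ (p + 1) q x = 0 → ∃ y, δ p q y = x :=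
    fun p q x hx => hexact (p + 1) q (by omega) x hx
  constructor
  · intro α hα hDα
    obtain ⟨γ, hγ, β, hβ, h⟩ := exists_sub_Dfun_eq_ιfun hdd hδδ hcomm hexact' r α hα
      (fun p q hp => hα p q (by omega)) (fun p q => by rw [hDα]; rfl)
    refine ⟨γ, hγ, ?_, β, hβ, fun p q => ?_⟩
    · rw [← ιfun_self 0 (r + 1) (d 0 r γ), ← Dfun_ιfun hγ, ← h, Dfun_sub,
        Dfun_Dfun hdd hδδ hcomm, hDα]
      simp
    · rw [← h, Pi.sub_apply, Pi.sub_apply, sub_add_cancel]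
  · rintro γ hγ - ⟨β, hβ, hβγ⟩
    rcases r with _ | r
    · have hβ0 : β = 0 := funext fun p => funext fun q => hβ p q (by omega)
      refine ⟨0, map_zero _, ?_⟩
      rw [hβγ, hβ0, Dfun_zero, map_zero]
      funext p q
      simp [ιfun, castC]
      rintro rfl rfl
      rfl
    · obtain ⟨γ', hγ', β', -, h⟩ := exists_sub_Dfun_eq_ιfun (r := r) hdd hδδ hcomm hexact' r β
        (fun p q hpq => hβ p q (by omega)) (fun p q (hp : r < p) => hβ p q (by omega))
        (fun p q => by rw [← hβγ, ιfun_of_ne _ (by omega)])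
      refine ⟨γ', hγ', ?_⟩
      rw [hβγ, ← sub_zero (Dfun C d δ β), ← Dfun_Dfun hdd hδδ hcomm β', ← Dfun_sub, h]
      exact (Dfun_ιfun hγ').symm
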